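/- Let D be a nonempty open connected subset of the quaternions ℍ and let f : D → ℍ. If for every q ∈ D the limit lim_{h→0, h≠0} h⁻¹ (f(q+h) − f(q)) exists in ℍ (the limit taken along the punctured neighborhood filter of 0 in ℍ), then f is a right-affine function: there exist ν, λ ∈ ℍ such that f(q) = qν + λ for all q ∈ D. -/

import Mathlib

open scoped Quaternion
open Filter Topology

/-- A quaternion from its coordinates. -/
def auxQ (a b c d : ℝ) : ℍ[ℝ] := ⟨a, b, c, d⟩

@[simp] theorem auxQ_re (a b c d : ℝ) : (auxQ a b c d).re = a := rfl
@[simp] theorem auxQ_imI (a b c d : ℝ) : (auxQ a b c d).imI = b := rfl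
@[simp] theorem auxQ_imJ (a b c d : ℝ) : (auxQ a b c d).imJ = c := rfl
@[simp] theorem auxQ_imK (a b c d : ℝ) : (auxQ a b c d).imK = d := rfl

/-- The complex derivative along a one-variable slice is itself differentiable. -/
theorem aux_deriv_tendsto {E : Type*} [NormedAddCommGroup E] [NormedSpace ℂ E] [CompleteSpace E]
    (F F' : ℂ → E) (h : ∀ᶠ z in 𝓝 (0 : ℂ), Tendsto (fun h : ℂ => h⁻¹ • (F (z + h) - F z))
      (𝓝[≠] 0) (𝓝 (F' z))) :
    ∃ G, Tendsto (fun h : ℂ => h⁻¹ • (F' h - F' 0)) (𝓝[≠] 0) (𝓝 G) := by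
  obtain ⟨U, hU, hUo, h0⟩ := eventually_nhds_iff.1 h
  have hd : ∀ z ∈ U, HasDerivAt F (F' z) z := fun z hz =>
    hasDerivAt_iff_tendsto_slope_zero.2 (hU z hz)
  have hdiff : DifferentiableOn ℂ F U := fun z hz => (hd z hz).differentiableAt.differentiableWithinAt
  have h2 : DifferentiableAt ℂ (deriv F) 0 := (hdiff.deriv hUo).differentiableAt (hUo.mem_nhds h0)
  have heq : F' =ᶠ[𝓝 0] deriv F := by
    filter_upwards [hUo.mem_nhds h0] with z hz using (hd z hz).deriv.symm
  have h3 := (h2.hasDerivAt.congr_of_eventuallyEq heq)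
  have h4 := hasDerivAt_iff_tendsto_slope_zero.1 h3
  simp only [zero_add] at h4
  exact ⟨_, h4⟩

/-- The embedding of the complex numbers determined by a unit `I`. -/
noncomputable def auxPhi (I : ℍ[ℝ]) (hI : I * I = -1) : ℂ →ₐ[ℝ] ℍ[ℝ] := Complex.lift ⟨I, hI⟩

theorem auxPhi_apply (I : ℍ[ℝ]) (hI : I * I = -1) (z : ℂ) :
    auxPhi I hI z = (z.re : ℍ[ℝ]) + z.im • I := by
  simp only [auxPhi, Complex.lift_apply, Complex.liftAux_apply]
  rfl

theorem auxPhi_norm (I : ℍ[ℝ]) (hI : I * I = -1) (hre : I.re = 0) (z : ℂ) :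
    ‖auxPhi I hI z‖ = ‖z‖ := by
  have h1 : I.imI ^ 2 + I.imJ ^ 2 + I.imK ^ 2 = 1 := by
    have := congrArg (fun q : ℍ[ℝ] => q.re) hI
    simp [hre] at this
    linarith
  have h2 : ‖auxPhi I hI z‖ * ‖auxPhi I hI z‖ = ‖z‖ * ‖z‖ := by
    rw [← Quaternion.normSq_eq_norm_mul_self, Complex.norm_mul_self_eq_normSq, Complex.normSq_apply,
      auxPhi_apply, Quaternion.normSq_def']
    simp [hre]
    linear_combination (z.im ^ 2) * h1
  exact (mul_self_inj (norm_nonneg _) (norm_nonneg _)).1 h2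

theorem aux_slice (I : ℍ[ℝ]) (hI : I * I = -1) (hre : I.re = 0) (F F' : ℂ → ℍ[ℝ])
    (h : ∀ᶠ z in 𝓝 (0 : ℂ), Tendsto (fun h : ℂ => (auxPhi I hI h)⁻¹ * (F (z + h) - F z))
      (𝓝[≠] 0) (𝓝 (F' z))) :
    ∃ G, Tendsto (fun h : ℂ => (auxPhi I hI h)⁻¹ * (F' h - F' 0)) (𝓝[≠] 0) (𝓝 G) := by
  letI m : Module ℂ ℍ[ℝ] := Module.compHom ℍ[ℝ] (auxPhi I hI : ℂ →+* ℍ[ℝ])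
  have hs : ∀ (z : ℂ) (q : ℍ[ℝ]), z • q = auxPhi I hI z * q := fun _ _ => rfl
  letI n : NormedSpace ℂ ℍ[ℝ] :=
    { m with
      norm_smul_le := fun z q => (by
        rw [norm_mul, auxPhi_norm I hI hre] : ‖auxPhi I hI z * q‖ ≤ ‖z‖ * ‖q‖) }
  have hs' : ∀ (z : ℂ) (q : ℍ[ℝ]), (auxPhi I hI z)⁻¹ * q = z⁻¹ • q := fun z q => by
    rw [← map_inv₀]; rfl
  simp only [hs'] at h ⊢
  exact aux_deriv_tendsto F F' h

/-- The directional derivative of the derivative function. -/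
def AuxDir (L : ℍ[ℝ] → ℍ[ℝ]) (q v m : ℍ[ℝ]) : Prop :=
  HasDerivAt (fun t : ℝ => L (q + t • v)) m 0

theorem aux_dir (D : Set ℍ[ℝ]) (hD : IsOpen D) (f L : ℍ[ℝ] → ℍ[ℝ])
    (hf : ∀ q ∈ D, Tendsto (fun h : ℍ[ℝ] => h⁻¹ * (f (q + h) - f q)) (𝓝[≠] 0) (𝓝 (L q)))
    (q : ℍ[ℝ]) (hq : q ∈ D) (I u : ℍ[ℝ]) (hI : I * I = -1) (hre : I.re = 0) (hu : u ≠ 0) :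
    ∃ G, ∀ c : ℂ, AuxDir L q (auxPhi I hI c * u) (u⁻¹ * (auxPhi I hI c * G)) := by
  have hcont : Continuous (auxPhi I hI) := by
    have : (auxPhi I hI : ℂ → ℍ[ℝ]) = fun z => (z.re : ℍ[ℝ]) + z.im • I :=
      funext (auxPhi_apply I hI)
    rw [this]
    exact (Quaternion.continuous_coe.comp Complex.continuous_re).add
      (Complex.continuous_im.smul continuous_const)
  have hne : ∀ z : ℂ, z ≠ 0 → auxPhi I hI z ≠ 0 := fun z hz => by
    rwa [Ne, map_eq_zero]
  obtain ⟨G, hG⟩ := aux_slice I hI hre (fun z => f (q + auxPhi I hI z * u))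
    (fun z => u * L (q + auxPhi I hI z * u)) (by
      have hev : ∀ᶠ z in 𝓝 (0 : ℂ), q + auxPhi I hI z * u ∈ D := by
        have hc : Continuous fun z : ℂ => q + auxPhi I hI z * u := by fun_prop
        apply hc.continuousAt.eventually_mem
        simpa using hD.mem_nhds hq
      filter_upwards [hev] with z hz
      have h1 : Tendsto (fun h : ℂ => auxPhi I hI h * u) (𝓝[≠] 0) (𝓝[≠] 0) := by
        refine tendsto_nhdsWithin_iff.2 ⟨?_, ?_⟩
        · have hc : Continuous fun z : ℂ => auxPhi I hI z * u := by fun_prop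
          have := hc.tendsto 0
          simp only [map_zero, zero_mul] at this
          exact this.mono_left nhdsWithin_le_nhds
        · filter_upwards [self_mem_nhdsWithin] with h hh
          exact mul_ne_zero (hne h hh) hu
      have h2 := ((hf _ hz).comp h1).const_mul u
      refine h2.congr fun h => ?_
      simp only [Function.comp, mul_inv_rev, map_add, add_mul, ← mul_assoc, mul_inv_cancel₀ hu,
        one_mul, add_assoc])
  refine ⟨G, fun c => ?_⟩
  unfold AuxDir
  by_cases hc : c = 0
  · subst hc
    simpa using hasDerivAt_const (0 : ℝ) (L q)
  rw [hasDerivAt_iff_tendsto_slope_zero]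
  have h1 : Tendsto (fun t : ℝ => (t : ℂ) * c) (𝓝[≠] 0) (𝓝[≠] 0) := by
    refine tendsto_nhdsWithin_iff.2 ⟨?_, ?_⟩
    · have hcc : Continuous fun t : ℝ => (t : ℂ) * c := by fun_prop
      have := hcc.tendsto 0
      simp only [Complex.ofReal_zero, zero_mul] at this
      exact this.mono_left nhdsWithin_le_nhds
    · filter_upwards [self_mem_nhdsWithin] with t ht
      exact mul_ne_zero (Complex.ofReal_ne_zero.2 ht) hc
  have h2 := ((hG.comp h1).const_mul (auxPhi I hI c)).const_mul u⁻¹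
  refine h2.congr fun t => ?_
  have e1 : auxPhi I hI ((t : ℂ) * c) = t • auxPhi I hI c := by
    rw [← Complex.real_smul, map_smul]
  have e2 : (t • auxPhi I hI c)⁻¹ = t⁻¹ • (auxPhi I hI c)⁻¹ := by
    rw [← map_smul, ← map_inv₀, ← map_inv₀, ← map_smul]
    congr 1
    simp [mul_comm]
  have e3 : ∀ x : ℍ[ℝ], auxPhi I hI c * ((auxPhi I hI c)⁻¹ * x) = x := fun x => by
    rw [← mul_assoc, mul_inv_cancel₀ (hne c hc), one_mul]
  have e4 : ∀ x : ℍ[ℝ], u⁻¹ * (u * x) = x := fun x => by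
    rw [← mul_assoc, inv_mul_cancel₀ hu, one_mul]
  simp only [Function.comp, e1, e2, map_zero, zero_mul, add_zero, zero_add, zero_smul,
    smul_mul_assoc, mul_smul_comm, e3, ← mul_sub, e4]

theorem aux_decomp (v : ℍ[ℝ]) : ∃ (I : ℍ[ℝ]) (hI : I * I = -1) (c : ℂ),
    I.re = 0 ∧ auxPhi I hI c = v := by
  set r := Real.sqrt (v.imI ^ 2 + v.imJ ^ 2 + v.imK ^ 2) with hr
  have hr2 : r ^ 2 = v.imI ^ 2 + v.imJ ^ 2 + v.imK ^ 2 := Real.sq_sqrt (by positivity)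
  by_cases h0 : r = 0
  · have hi : v.imI = 0 := by nlinarith [sq_nonneg v.imI, sq_nonneg v.imJ, sq_nonneg v.imK]
    have hj : v.imJ = 0 := by nlinarith [sq_nonneg v.imI, sq_nonneg v.imJ, sq_nonneg v.imK]
    have hk : v.imK = 0 := by nlinarith [sq_nonneg v.imI, sq_nonneg v.imJ, sq_nonneg v.imK]
    refine ⟨(auxQ 0 1 0 0), by ext <;> simp, ⟨v.re, 0⟩, rfl, ?_⟩
    rw [auxPhi_apply]
    ext <;> simp [hi, hj, hk]
  · refine ⟨auxQ 0 (v.imI / r) (v.imJ / r) (v.imK / r), ?_, ⟨v.re, r⟩, rfl, ?_⟩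
    · ext
      · simp
        field_simp
        linarith
      all_goals simp
      all_goals ring
    · rw [auxPhi_apply]
      ext <;> simp <;> field_simp

theorem aux_dir_zero (D : Set ℍ[ℝ]) (hD : IsOpen D) (f L : ℍ[ℝ] → ℍ[ℝ])
    (hf : ∀ q ∈ D, Tendsto (fun h : ℍ[ℝ] => h⁻¹ * (f (q + h) - f q)) (𝓝[≠] 0) (𝓝 (L q)))
    (q : ℍ[ℝ]) (hq : q ∈ D) (v : ℍ[ℝ]) : AuxDir L q v 0 := by
  have key : AuxDir L q 1 0 := by
    have hi : (auxQ 0 1 0 0) * (auxQ 0 1 0 0) = -1 := by ext <;> simp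
    have hj : (auxQ 0 0 1 0) * (auxQ 0 0 1 0) = -1 := by ext <;> simp
    have hk : (auxQ 0 0 0 1) * (auxQ 0 0 0 1) = -1 := by ext <;> simp
    have hij : (auxQ 0 1 0 0) * (auxQ 0 0 1 0) = (auxQ 0 0 0 1) := by ext <;> simp
    have hj0 : (auxQ 0 0 1 0) ≠ 0 := fun h => by
      simpa using congrArg (fun q : ℍ[ℝ] => q.imJ) h
    have hjinv : (auxQ 0 0 1 0)⁻¹ = -(auxQ 0 0 1 0) :=
      inv_eq_of_mul_eq_one_right (by rw [mul_neg, hj, neg_neg])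
    have hphi : ∀ (I : ℍ[ℝ]) (hI : I * I = -1), auxPhi I hI Complex.I = I := fun I hI => by
      rw [auxPhi_apply]; simp
    obtain ⟨G1, h1⟩ := aux_dir D hD f L hf q hq _ (auxQ 0 0 1 0) hi rfl hj0
    obtain ⟨G2, h2⟩ := aux_dir D hD f L hf q hq _ 1 hj rfl one_ne_zero
    obtain ⟨G3, h3⟩ := aux_dir D hD f L hf q hq _ 1 hk rfl one_ne_zero
    have a1 := h1 1
    have b1 := h1 Complex.I
    have a2 := h2 1
    have b2 := h2 Complex.I
    have a3 := h3 1
    have b3 := h3 Complex.I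
    simp only [hphi, map_one, one_mul, mul_one, inv_one, hij, hjinv] at a1 b1 a2 b2 a3 b3
    have e1 := HasDerivAt.unique a2 a3
    have e2 := HasDerivAt.unique a1 b2
    have e3 := HasDerivAt.unique b1 b3
    subst e1
    have : G2 = 0 := by
      simp only [Quaternion.ext_iff, Quaternion.re_mul, Quaternion.imI_mul, Quaternion.imJ_mul,
        Quaternion.imK_mul, Quaternion.re_neg, Quaternion.imI_neg, Quaternion.imJ_neg,
        Quaternion.imK_neg, auxQ_re, auxQ_imI, auxQ_imJ, auxQ_imK] at e2 e3
      obtain ⟨p1, p2, p3, p4⟩ := e2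
      obtain ⟨r1, r2, r3, r4⟩ := e3
      ext <;> simp <;> linarith
    rwa [this] at a2
  obtain ⟨I, hI, c, hre, rfl⟩ := aux_decomp v
  obtain ⟨G, hG⟩ := aux_dir D hD f L hf q hq I 1 hI hre one_ne_zero
  have a := hG 1
  have b := hG c
  simp only [map_one, one_mul, mul_one, inv_one] at a b
  have : G = 0 := HasDerivAt.unique a key
  simpa [this] using b

/-- **Right quaternion differentiability forces right-affine form.**
If `D ⊆ ℍ` is a nonempty open connected set and for every `q ∈ D` the limit
`lim_{h→0, h≠0} h⁻¹ (f(q+h) − f(q))` exists, then `f(q) = q ν + λ` on `D`. -/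
theorem right_quaternion_differentiable_is_affine
    (D : Set ℍ[ℝ]) (hD_open : IsOpen D) (hD_conn : IsConnected D)
    (f : ℍ[ℝ] → ℍ[ℝ])
    (hf : ∀ q ∈ D, ∃ L : ℍ[ℝ],
      Filter.Tendsto (fun h : ℍ[ℝ] => h⁻¹ * (f (q + h) - f q))
        (nhdsWithin (0 : ℍ[ℝ]) {(0 : ℍ[ℝ])}ᶜ) (nhds L)) :
    ∃ ν lambda : ℍ[ℝ], ∀ q ∈ D, f q = q * ν + lambda := by
  choose! L hL using hf
  have hdir := aux_dir_zero D hD_open f L hL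
  have hloc : ∀ q ∈ D, L =ᶠ[𝓝 q] fun _ => L q := by
    intro q hq
    obtain ⟨ε, hε, hb⟩ := Metric.isOpen_iff.1 hD_open q hq
    filter_upwards [Metric.ball_mem_nhds q hε] with p hp
    have hd : ∀ t ∈ Set.Icc (0 : ℝ) 1, HasDerivAt (fun t : ℝ => L (q + t • (p - q))) 0 t := by
      intro t ht
      have hm : q + t • (p - q) ∈ D := by
        apply hb
        exact (convex_ball q ε).add_smul_sub_mem (Metric.mem_ball_self hε) hp ht
      have h1 := hdir _ hm (p - q)
      unfold AuxDir at h1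
      have h2 : HasDerivAt (fun s : ℝ => L (q + t • (p - q) + (s - t) • (p - q))) 0 t := by
        have := HasDerivAt.comp_sub_const (f := fun s : ℝ => L (q + t • (p - q) + s • (p - q)))
          (f' := 0) t t (by simpa using h1)
        exact this
      refine h2.congr_of_eventuallyEq (Eventually.of_forall fun s => ?_)
      simp only
      congr 1
      module
    have := constant_of_has_deriv_right_zero (a := (0 : ℝ)) (b := 1)
      (f := fun t : ℝ => L (q + t • (p - q)))
      (fun t ht => (hd t ht).continuousAt.continuousWithinAt)
      (fun t ht => (hd t ⟨ht.1, ht.2.le⟩).hasDerivWithinAt) 1 (by simp)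
    simpa using this
  obtain ⟨q0, hq0⟩ := hD_conn.nonempty
  have hLc : ∀ q ∈ D, L q = L q0 := fun q hq => by
    have hd : ∀ q ∈ D, HasFDerivAt L (0 : ℍ[ℝ] →L[ℝ] ℍ[ℝ]) q := fun q hq =>
      (hasFDerivAt_const (L q) q).congr_of_eventuallyEq (hloc q hq)
    exact hD_open.is_const_of_fderiv_eq_zero (𝕜 := ℝ) hD_conn.isPreconnected
      (fun x hx => (hd x hx).differentiableAt.differentiableWithinAt)
      (fun x hx => (hd x hx).fderiv) hq hq0
  have hd : ∀ q ∈ D, HasFDerivAt (fun q => f q - q * L q0) (0 : ℍ[ℝ] →L[ℝ] ℍ[ℝ]) q := by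
    intro q hq
    have h1 := hL q hq
    rw [hLc q hq] at h1
    rw [hasFDerivAt_iff_isLittleO_nhds_zero, Asymptotics.isLittleO_iff]
    intro c hc
    have h2 := (Metric.tendsto_nhds.1 h1) c hc
    rw [eventually_nhdsWithin_iff] at h2
    filter_upwards [h2] with h hh
    by_cases h0 : h = 0
    · simp [h0]
    have h3 := hh h0
    rw [dist_eq_norm] at h3
    have e : f (q + h) - (q + h) * L q0 - (f q - q * L q0) - (0 : ℍ[ℝ] →L[ℝ] ℍ[ℝ]) h
        = h * (h⁻¹ * (f (q + h) - f q) - L q0) := by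
      rw [mul_sub, ← mul_assoc, mul_inv_cancel₀ h0]
      simp only [zero_apply]
      noncomm_ring
    rw [e, norm_mul, mul_comm]
    gcongr
  refine ⟨L q0, f q0 - q0 * L q0, fun q hq => ?_⟩
  have := hD_open.is_const_of_fderiv_eq_zero (𝕜 := ℝ) hD_conn.isPreconnected
      (fun x hx => (hd x hx).differentiableAt.differentiableWithinAt)
      (fun x hx => (hd x hx).fderiv) hq hq0
  rw [← this]
  abel
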